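/- arXiv:2210.12577 — 2 statements merged into one kernel-verified Lean document; each statement's English description precedes it below -/
import Mathlib

section
/- Every non-trivial graph G has a T-partition of width at most (1+√2)·(tw(G)+1)·(3·(1+√2)·Δ(G) − 1) for some tree T with maximum degree Δ(T) ≤ (3+3√2)·Δ(G) − 3·(√2 − 1). -/
open SimpleGraph

/-- The maximum degree of a finite simple graph `G`:
the supremum of the numbers of neighbours of its vertices. -/
noncomputable def maxDeg {V : Type*} [Fintype V] (G : SimpleGraph V) : ℕ :=
  sSup (Set.range fun v => (G.neighborSet v).ncard)

/-- `B` is a `T`-partition of the graph `G`: the tree `T` indexes a partition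
`(B x : x ∈ V(T))` of `V(G)` such that for every edge `vw` of `G`, if `v ∈ B x` and
`w ∈ B y` then `x = y` or `xy ∈ E(T)`. -/
structure IsTreePartition {V ι : Type*} (G : SimpleGraph V) (T : SimpleGraph ι)
    (B : ι → Set V) : Prop where
  /-- `T` is a tree. -/
  isTree : T.IsTree
  /-- the parts are nonempty -/
  part_nonempty : ∀ x, (B x).Nonempty
  /-- every vertex of `G` lies in exactly one part -/
  part_existsUnique : ∀ v, ∃! x, v ∈ B x
  /-- parts containing adjacent vertices are equal or adjacent in `T` -/
  part_adj : ∀ ⦃v w x y⦄, G.Adj v w → v ∈ B x → w ∈ B y → x = y ∨ T.Adj x y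

/-- `B` is a tree-decomposition of the graph `G` over the tree `T`:
every edge of `G` has both ends in a common bag, and for each vertex `v` of `G`
the set of nodes whose bag contains `v` induces a non-empty subtree of `T`. -/
structure IsTreeDecomp {V ι : Type*} (G : SimpleGraph V) (T : SimpleGraph ι)
    (B : ι → Set V) : Prop where
  /-- `T` is a tree. -/
  isTree : T.IsTree
  /-- every edge of `G` lies in some bag -/
  edge_mem : ∀ ⦃u v⦄, G.Adj u v → ∃ x, u ∈ B x ∧ v ∈ B x
  /-- the bags containing a given vertex induce a non-empty subtree -/
  subtree : ∀ v, (T.induce {x | v ∈ B x}).Connected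

/-- The treewidth of a finite graph: the minimum, over tree-decompositions,
of the maximum bag size minus one. -/
noncomputable def treewidth {V : Type} [Fintype V] (G : SimpleGraph V) : ℕ :=
  sInf {k | ∃ (ι : Type) (_ : Fintype ι) (T : SimpleGraph ι) (B : ι → Set V),
    IsTreeDecomp G T B ∧ ∀ x, (B x).ncard ≤ k + 1}

/-- The tree-partition-width of a finite graph: the minimum width of a tree-partition. -/
noncomputable def tpw {V : Type} [Fintype V] (G : SimpleGraph V) : ℕ :=
  sInf {k | ∃ (ι : Type) (_ : Fintype ι) (T : SimpleGraph ι) (B : ι → Set V),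
    IsTreePartition G T B ∧ ∀ x, (B x).ncard ≤ k}


/-- `a` is a node other than the root `none`, and its parent is `b`. -/
def IsParent {κ : Type} (parent : κ → Option κ) (a b : Option κ) : Prop :=
  ∃ x, a = some x ∧ parent x = b

/-- The tree on `Option κ` with root `none` in which the parent of `some x` is `parent x`. -/
def parentGraph {κ : Type} (parent : κ → Option κ) : SimpleGraph (Option κ) :=
  SimpleGraph.fromRel (IsParent parent)

section ParentGraph

variable {κ : Type} {parent : κ → Option κ} {height : κ → ℕ}

theorem parentGraph_adj_parent (hh : ∀ x y, parent x = some y → height y < height x) (x : κ) :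
    (parentGraph parent).Adj (some x) (parent x) := by
  refine ⟨fun h => ?_, Or.inl ⟨x, rfl, rfl⟩⟩
  exact (hh x x h.symm).false

theorem parentGraph_isTree [Finite κ]
    (hh : ∀ x y, parent x = some y → height y < height x) : (parentGraph parent).IsTree := by
  have hreach : ∀ n x, height x = n → (parentGraph parent).Reachable (some x) none := by
    intro n
    induction n using Nat.strong_induction_on with
    | _ n ih =>
      intro x hx
      have hadj := (parentGraph_adj_parent hh x).reachable
      cases hp : parent x with
      | none => rwa [hp] at hadj
      | some y =>
        rw [hp] at hadj
        exact hadj.trans (ih _ (hx ▸ hh x y hp) y rfl)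
  have hroot : ∀ a, (parentGraph parent).Reachable a none := by
    rintro (_ | x)
    · rfl
    · exact hreach _ x rfl
  rw [isTree_iff_connected_and_card]
  refine ⟨⟨fun a b => (hroot a).trans (hroot b).symm⟩, ?_⟩
  rw [Finite.card_option]
  congr 1
  symm
  refine Nat.card_congr (Equiv.ofBijective
    (fun x => ⟨s(some x, parent x), parentGraph_adj_parent hh x⟩) ⟨fun x y hxy => ?_, ?_⟩)
  · have hxy' : s(some x, parent x) = s(some y, parent y) := congrArg Subtype.val hxy
    rcases Sym2.eq_iff.1 hxy' with ⟨h, -⟩ | ⟨h1, h2⟩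
    · exact Option.some_injective _ h
    · have := hh x y h2
      have := hh y x h1.symm
      omega
  · rintro ⟨e, he⟩
    induction e with
    | _ a b =>
      have hab : (parentGraph parent).Adj a b := he
      rcases hab with ⟨-, ⟨x, hx, hp⟩ | ⟨x, hx, hp⟩⟩
      · exact ⟨x, Subtype.ext (congrArg₂ (fun c e => s(c, e)) hx.symm hp)⟩
      · exact ⟨x, Subtype.ext ((congrArg₂ (fun c e => s(c, e)) hx.symm hp).trans Sym2.eq_swap)⟩

theorem ncard_neighborSet_none [Finite κ] :
    ((parentGraph parent).neighborSet none).ncard ≤ {y | parent y = none}.ncard := by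
  refine (Set.ncard_le_ncard (t := some '' {y | parent y = none}) ?_).trans
    (Set.ncard_image_le (Set.toFinite _))
  rintro b ⟨-, ⟨x, hx, -⟩ | ⟨x, rfl, hx⟩⟩
  · cases hx
  · exact ⟨x, hx, rfl⟩

theorem ncard_neighborSet_some [Finite κ] (z : κ) :
    ((parentGraph parent).neighborSet (some z)).ncard ≤ {y | parent y = some z}.ncard + 1 := by
  refine (Set.ncard_le_ncard (t := insert (parent z) (some '' {y | parent y = some z})) ?_).trans
    ((Set.ncard_insert_le _ _).trans
      (Nat.add_le_add_right (Set.ncard_image_le (Set.toFinite _)) 1))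
  rintro b ⟨-, ⟨x, hx, rfl⟩ | ⟨x, rfl, hx⟩⟩
  · cases hx
    exact Or.inl rfl
  · exact Or.inr ⟨x, hx, rfl⟩

end ParentGraph

/-- The graph obtained from `T` by deleting all edges at `x`. -/
def isolate {ι : Type} (T : SimpleGraph ι) (x : ι) : SimpleGraph ι where
  Adj a b := T.Adj a b ∧ a ≠ x ∧ b ≠ x
  symm := ⟨fun _ _ h => ⟨h.1.symm, h.2.2, h.2.1⟩⟩
  loopless := ⟨fun _ h => h.1.ne rfl⟩

section Isolate

variable {ι : Type} {T : SimpleGraph ι}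

theorem eq_of_isolate_reachable {x a : ι} (h : (isolate T x).Reachable x a) : a = x := by
  by_contra hne
  obtain ⟨w⟩ := h
  cases w with
  | nil => exact hne rfl
  | cons h _ => exact h.2.1 rfl

theorem isolate_reachable_of_connected {s : Set ι} (hs : (T.induce s).Connected) {x a b : ι}
    (hx : x ∉ s) (ha : a ∈ s) (hb : b ∈ s) : (isolate T x).Reachable a b := by
  let φ : T.induce s →g isolate T x :=
    ⟨Subtype.val, fun {c d} h => ⟨h, fun e => hx (e ▸ c.2), fun e => hx (e ▸ d.2)⟩⟩
  exact (hs.preconnected ⟨a, ha⟩ ⟨b, hb⟩).map φ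

/-- A component of a connected graph minus `x` contains a neighbour of `x`. -/
theorem exists_adj_isolate_reachable (hT : T.Connected) {x b : ι} (hb : b ≠ x) :
    ∃ y, T.Adj x y ∧ (isolate T x).Reachable b y := by
  obtain ⟨w⟩ := hT.preconnected b x
  obtain ⟨e, -, h1, h2⟩ := w.exists_boundary_dart {a | (isolate T x).Reachable b a}
    (Reachable.refl b) (fun h => hb (eq_of_isolate_reachable (Reachable.symm h)))
  have hfst : e.fst ≠ x := fun h => by
    rw [Set.mem_ofPred_eq, h] at h1
    exact hb (eq_of_isolate_reachable h1.symm)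
  have hsnd : e.snd = x := by
    by_contra hne
    exact h2 (Reachable.trans h1 (Adj.reachable ⟨e.adj, hfst, hne⟩))
  exact ⟨e.fst, hsnd ▸ e.adj.symm, h1⟩

theorem not_isolate_reachable_of_adj (hT : T.IsAcyclic) {x y b : ι} (hxy : T.Adj x y)
    (hy : (isolate T x).Reachable b y) (hx : (isolate T y).Reachable b x) : False := by
  have hbr := isAcyclic_iff_forall_adj_isBridge.1 hT hxy
  rw [isBridge_iff] at hbr
  have h1 : isolate T x ≤ T.deleteEdges {s(x, y)} := fun a c h => by
    rw [deleteEdges_adj]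
    refine ⟨h.1, fun e => ?_⟩
    rcases Sym2.eq_iff.1 e with ⟨e, -⟩ | ⟨-, e⟩
    exacts [h.2.1 e, h.2.2 e]
  have h2 : isolate T y ≤ T.deleteEdges {s(x, y)} := fun a c h => by
    rw [deleteEdges_adj]
    refine ⟨h.1, fun e => ?_⟩
    rcases Sym2.eq_iff.1 e with ⟨-, e⟩ | ⟨e, -⟩
    exacts [h.2.2 e, h.2.1 e]
  exact hbr ((hx.mono h2).symm.trans (hy.mono h1))

/-- If `y` is a neighbour of `x`, a component avoiding `x` of the tree minus `y` which meets the
component of `y` in the tree minus `x` is contained in the latter. -/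
theorem isolate_reachable_of_not_reachable {x y b a : ι}
    (hx : ¬ (isolate T y).Reachable b x) (ha : (isolate T y).Reachable b a) :
    (isolate T x).Reachable b a := by
  obtain ⟨w⟩ := ha
  induction w with
  | nil => rfl
  | @cons c e _ h w ih =>
    have hadj : (isolate T x).Adj c e := by
      refine ⟨h.1, ?_, ?_⟩
      · rintro rfl
        exact hx (Reachable.refl _)
      · rintro rfl
        exact hx h.reachable
    exact hadj.reachable.trans (ih fun h' => hx (h.reachable.trans h'))

end Isolate

open Classical in
/-- Some bag of a tree-decomposition is such that each component of the tree minus its node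
carries at most half of `S`. -/
theorem IsTreeDecomp.exists_balanced {V ι : Type} [Fintype ι] {G : SimpleGraph V}
    {T : SimpleGraph ι} {B : ι → Set V} (hB : IsTreeDecomp G T B) (node : V → ι)
    (hnode : ∀ v, v ∈ B (node v)) (S : Finset V) :
    ∃ x, ∀ c, 2 * (S.filter fun v => v ∉ B x ∧
      (isolate T x).connectedComponentMk (node v) = c).card ≤ S.card := by
  by_contra! hcon
  choose c hc using hcon
  have : Nonempty ι := hB.isTree.connected.nonempty
  obtain ⟨x, hxmin⟩ := Finite.exists_min fun x => (c x).supp.ncard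
  obtain ⟨v₀, hv₀⟩ : (S.filter fun v => v ∉ B x ∧
      (isolate T x).connectedComponentMk (node v) = c x).Nonempty := by
    rw [← Finset.card_pos]
    have := hc x
    omega
  simp only [Finset.mem_filter] at hv₀
  obtain ⟨-, hv₀x, hv₀c⟩ := hv₀
  obtain ⟨y, hxy, hy⟩ := exists_adj_isolate_reachable hB.isTree.connected
    (x := x) (b := node v₀) fun h => hv₀x (h ▸ hnode v₀)
  obtain ⟨v, hv⟩ : ((S.filter fun v => v ∉ B x ∧
      (isolate T x).connectedComponentMk (node v) = c x) ∩ (S.filter fun v => v ∉ B y ∧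
      (isolate T y).connectedComponentMk (node v) = c y)).Nonempty := by
    refine Finset.inter_nonempty_of_card_lt_card_add_card (s := S) (Finset.filter_subset _ _)
      (Finset.filter_subset _ _) ?_
    have := hc x
    have := hc y
    omega
  simp only [Finset.mem_inter, Finset.mem_filter] at hv
  obtain ⟨⟨-, -, hvx⟩, -, hvBy, hvy⟩ := hv
  have hvy' : (isolate T x).Reachable (node v) y := by
    rw [← hvx, ConnectedComponent.eq] at hv₀c
    exact hv₀c.symm.trans hy
  have hnx : ¬ (isolate T y).Reachable (node v) x := fun h =>
    not_isolate_reachable_of_adj hB.isTree.isAcyclic hxy hvy' h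
  refine (hxmin y).not_gt (Set.ncard_lt_ncard ⟨fun a ha => ?_, fun hsub => ?_⟩)
  · rw [ConnectedComponent.mem_supp_iff, ← hvy, ConnectedComponent.eq] at ha
    rw [ConnectedComponent.mem_supp_iff, ← hvx, ConnectedComponent.eq]
    exact (isolate_reachable_of_not_reachable hnx ha.symm).symm
  · have hmem : y ∈ (c x).supp := by
      rw [ConnectedComponent.mem_supp_iff, ← hvx, ConnectedComponent.eq]
      exact hvy'.symm
    have := hsub hmem
    rw [ConnectedComponent.mem_supp_iff, ← hvy, ConnectedComponent.eq] at this
    exact hvBy (eq_of_isolate_reachable this ▸ hnode v)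

open Classical in
/-- If every fibre of `f` on `R` has size at most `n / 2`, the fibres can be grouped into two
classes, each of size at least `(n - k) / 3`. -/
theorem exists_balanced_grouping {V C : Type} (f : V → C) (R : Finset V) {n k : ℕ} (hk : 1 ≤ k)
    (hn : 4 * k ≤ n) (hR : n ≤ R.card + k)
    (hf : ∀ c, 2 * (R.filter fun v => f v = c).card ≤ n) :
    ∃ I : Finset C, n ≤ 3 * (R.filter fun v => f v ∈ I).card + k ∧
      n ≤ 3 * (R.filter fun v => f v ∉ I).card + k := by
  have hsplit : ∀ I : Finset C,
      (R.filter fun v => f v ∈ I).card + (R.filter fun v => f v ∉ I).card = R.card :=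
    fun I => Finset.card_filter_add_card_filter_not _
  by_cases hbig : ∃ c, n ≤ 3 * (R.filter fun v => f v = c).card + k
  · obtain ⟨c, hc⟩ := hbig
    refine ⟨{c}, ?_, ?_⟩
    · simpa using hc
    · have := hsplit {c}
      have := hf c
      simp only [Finset.mem_singleton] at *
      omega
  · push Not at hbig
    have hall : n ≤ 3 * (R.filter fun v => f v ∈ R.image f).card + k := by
      rw [Finset.filter_true_of_mem fun v hv => Finset.mem_image_of_mem f hv]
      omega
    obtain ⟨I, hI, hmin⟩ := exists_minimal_of_wellFoundedLT
      (fun I : Finset C => n ≤ 3 * (R.filter fun v => f v ∈ I).card + k) ⟨_, hall⟩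
    refine ⟨I, hI, ?_⟩
    obtain ⟨c, hc⟩ : I.Nonempty := by
      rw [Finset.nonempty_iff_ne_empty]
      rintro rfl
      simp at hI
      omega
    have hlt : 3 * (R.filter fun v => f v ∈ I.erase c).card + k < n := by
      by_contra! h
      exact Finset.notMem_erase c I (hmin h (Finset.erase_subset _ _) hc)
    have hunion : (R.filter fun v => f v ∈ I).card ≤
        (R.filter fun v => f v ∈ I.erase c).card + (R.filter fun v => f v = c).card := by
      refine (Finset.card_le_card fun v hv => ?_).trans (Finset.card_union_le _ _)
      simp only [Finset.mem_union, Finset.mem_filter, Finset.mem_erase] at hv ⊢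
      tauto
    have := hsplit I
    have := hbig c
    omega

open Classical in
/-- Balanced separations with a separator of size exactly `k`. -/
theorem IsTreeDecomp.exists_separation {V ι : Type} [Fintype ι] {G : SimpleGraph V}
    {T : SimpleGraph ι} {B : ι → Set V} [Finite V] (hB : IsTreeDecomp G T B) {k : ℕ} (hk : 1 ≤ k)
    (hcard : ∀ x, (B x).ncard ≤ k) {U S : Finset V} (hSU : S ⊆ U) (hS : 4 * k ≤ S.card) :
    ∃ X P Q : Finset V, X.card = k ∧ X ∪ P ∪ Q = U ∧ Disjoint X P ∧ Disjoint X Q ∧ Disjoint P Q ∧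
      (∀ u ∈ P, ∀ v ∈ Q, ¬ G.Adj u v) ∧
      S.card ≤ 3 * (S ∩ P).card + k ∧ S.card ≤ 3 * (S ∩ Q).card + k := by
  have hex : ∀ v, ∃ x, v ∈ B x := fun v => by
    obtain ⟨⟨x, hx⟩⟩ := (hB.subtree v).nonempty
    exact ⟨x, hx⟩
  choose node hnode using hex
  obtain ⟨x, hx⟩ := hB.exists_balanced node hnode S
  have hle : (U.filter (· ∈ B x)).card ≤ k := by
    rw [← Set.ncard_coe_finset]
    exact (Set.ncard_le_ncard (fun v hv => (Finset.mem_filter.1 hv).2)).trans (hcard x)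
  have hSle := Finset.card_le_card hSU
  obtain ⟨X, hX1, hXU, hXk⟩ := Finset.exists_subsuperset_card_eq (Finset.filter_subset _ U) hle
    (by omega : k ≤ U.card)
  set f : V → (isolate T x).ConnectedComponent :=
    fun v => (isolate T x).connectedComponentMk (node v)
  have hXB : ∀ v ∈ U, v ∉ X → v ∉ B x := fun v hv hvX hvB =>
    hvX (hX1 (Finset.mem_filter.2 ⟨hv, hvB⟩))
  obtain ⟨I, hI1, hI2⟩ := exists_balanced_grouping f (S \ X) hk hS
    (by have := Finset.le_card_sdiff X S; omega)
    (fun c => le_trans (Nat.mul_le_mul_left 2 (Finset.card_le_card fun v hv => by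
      simp only [Finset.mem_filter, Finset.mem_sdiff] at hv ⊢
      exact ⟨hv.1.1, hXB v (hSU hv.1.1) hv.1.2, hv.2⟩)) (hx c))
  refine ⟨X, (U \ X).filter (f · ∈ I), (U \ X).filter (f · ∉ I), hXk, ?_, ?_, ?_, ?_, ?_, ?_, ?_⟩
  · rw [Finset.union_assoc, Finset.filter_union_filter_not_eq, Finset.union_sdiff_of_subset hXU]
  · exact Finset.disjoint_of_subset_right (Finset.filter_subset _ _) Finset.disjoint_sdiff
  · exact Finset.disjoint_of_subset_right (Finset.filter_subset _ _) Finset.disjoint_sdiff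
  · exact Finset.disjoint_filter_filter_not _ _ _
  · intro u hu v hv huv
    simp only [Finset.mem_filter, Finset.mem_sdiff] at hu hv
    obtain ⟨a, hua, hva⟩ := hB.edge_mem huv
    have h1 : (isolate T x).Reachable (node u) a :=
      isolate_reachable_of_connected (hB.subtree u) (hXB u hu.1.1 hu.1.2) (hnode u) hua
    have h2 : (isolate T x).Reachable (node v) a :=
      isolate_reachable_of_connected (hB.subtree v) (hXB v hv.1.1 hv.1.2) (hnode v) hva
    have heq : f u = f v := ConnectedComponent.eq.2 (h1.trans h2.symm)
    exact hv.2 (heq ▸ hu.2)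
  · refine hI1.trans (Nat.add_le_add_right (Nat.mul_le_mul_left 3 (Finset.card_le_card ?_)) k)
    intro v hv
    simp only [Finset.mem_filter, Finset.mem_sdiff, Finset.mem_inter] at hv ⊢
    exact ⟨hv.1.1, ⟨hSU hv.1.1, hv.1.2⟩, hv.2⟩
  · refine hI2.trans (Nat.add_le_add_right (Nat.mul_le_mul_left 3 (Finset.card_le_card ?_)) k)
    intro v hv
    simp only [Finset.mem_filter, Finset.mem_sdiff, Finset.mem_inter] at hv ⊢
    exact ⟨hv.1.1, ⟨hSU hv.1.1, hv.1.2⟩, hv.2⟩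

/-- A partition of `U` indexed by the tree on `Option κ` given by `parent`, such that adjacent
vertices lie in the same part or in parts indexed by adjacent nodes. -/
structure RootedTreePartition {V : Type} (G : SimpleGraph V) (U : Finset V) (κ : Type) where
  /-- the parent of a node other than the root -/
  parent : κ → Option κ
  /-- the height of a node, showing that `parent` is well-founded -/
  height : κ → ℕ
  /-- the node whose part contains a given vertex -/
  label : V → Option κ
  height_lt : ∀ x y, parent x = some y → height y < height x
  label_surj : ∀ x : κ, ∃ u ∈ U, label u = some x
  label_adj : ∀ u ∈ U, ∀ v ∈ U, G.Adj u v →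
    label u = label v ∨ IsParent parent (label u) (label v) ∨ IsParent parent (label v) (label u)

namespace RootedTreePartition

variable {V κ κ₁ κ₂ : Type} {G : SimpleGraph V} {U S X P Q : Finset V}

open Classical in
/-- The part indexed by a node. -/
noncomputable def part (R : RootedTreePartition G U κ) (a : Option κ) : Finset V :=
  U.filter fun v => R.label v = a

/-- The children of a node. -/
def children (R : RootedTreePartition G U κ) (a : Option κ) : Set κ :=
  {y | R.parent y = a}

theorem mem_part {R : RootedTreePartition G U κ} {a : Option κ} {v : V} :
    v ∈ R.part a ↔ v ∈ U ∧ R.label v = a := by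
  simp [part]

theorem isTreePartition [Fintype V] [Finite κ] (R : RootedTreePartition G Finset.univ κ)
    (hroot : (R.part none).Nonempty) :
    IsTreePartition G (parentGraph R.parent) fun a => (R.part a : Set V) where
  isTree := parentGraph_isTree R.height_lt
  part_nonempty a := by
    cases a with
    | none => exact hroot
    | some x =>
      obtain ⟨u, hu, hx⟩ := R.label_surj x
      exact ⟨u, mem_part.2 ⟨hu, hx⟩⟩
  part_existsUnique v :=
    ⟨R.label v, mem_part.2 ⟨Finset.mem_univ v, rfl⟩, fun _ ha => (mem_part.1 ha).2.symm⟩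
  part_adj v w a b hvw hv hw := by
    obtain ⟨hvU, rfl⟩ := mem_part.1 hv
    obtain ⟨hwU, rfl⟩ := mem_part.1 hw
    by_cases heq : R.label v = R.label w
    · exact Or.inl heq
    · exact Or.inr ⟨heq, (R.label_adj v hvU w hwU hvw).resolve_left heq⟩

/-- The partition with a single part. -/
def single (G : SimpleGraph V) (U : Finset V) : RootedTreePartition G U Empty where
  parent := Empty.elim
  height := Empty.elim
  label _ := none
  height_lt x := x.elim
  label_surj x := x.elim
  label_adj _ _ _ _ _ := Or.inl rfl

theorem part_single : (single G U).part none = U := by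
  ext v
  simp [mem_part, single]

variable [DecidableEq V]

/-- Adding a new root with part `S` above the root of a partition of `U \ S`. -/
noncomputable def addRoot (R : RootedTreePartition G (U \ S) κ)
    (hne : (R.part none).Nonempty)
    (hadj : ∀ s ∈ S, ∀ v ∈ U \ S, G.Adj s v → v ∈ R.part none) :
    RootedTreePartition G U (Option κ) where
  parent x := x.elim none fun y => some (R.parent y)
  height x := x.elim 0 fun y => R.height y + 1
  label v := if v ∈ S then none else some (R.label v)
  height_lt x y h := by
    cases x with
    | none => simp at h
    | some x =>
      cases y with
      | none => simp
      | some y =>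
        have := R.height_lt x y (by simpa using h)
        simpa using this
  label_surj x := by
    cases x with
    | none =>
      obtain ⟨v, hv⟩ := hne
      obtain ⟨hvU, hv⟩ := mem_part.1 hv
      rw [Finset.mem_sdiff] at hvU
      exact ⟨v, hvU.1, by simp [hvU.2, hv]⟩
    | some x =>
      obtain ⟨v, hvU, hv⟩ := R.label_surj x
      rw [Finset.mem_sdiff] at hvU
      exact ⟨v, hvU.1, by simp [hvU.2, hv]⟩
  label_adj u hu v hv huv := by
    by_cases huS : u ∈ S <;> by_cases hvS : v ∈ S
    · simp [huS, hvS]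
    · have := (mem_part.1 (hadj u huS v (Finset.mem_sdiff.2 ⟨hv, hvS⟩) huv)).2
      exact Or.inr (Or.inr ⟨none, by simp [hvS, this], by simp [huS]⟩)
    · have := (mem_part.1 (hadj v hvS u (Finset.mem_sdiff.2 ⟨hu, huS⟩) huv.symm)).2
      exact Or.inr (Or.inl ⟨none, by simp [huS, this], by simp [hvS]⟩)
    · rcases R.label_adj u (Finset.mem_sdiff.2 ⟨hu, huS⟩) v (Finset.mem_sdiff.2 ⟨hv, hvS⟩) huv
        with h | ⟨x, h1, h2⟩ | ⟨x, h1, h2⟩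
      · exact Or.inl (by simp [huS, hvS, h])
      · exact Or.inr (Or.inl ⟨some x, by simp [huS, h1], by simp [hvS, h2]⟩)
      · exact Or.inr (Or.inr ⟨some x, by simp [hvS, h1], by simp [huS, h2]⟩)

section AddRoot

variable {R : RootedTreePartition G (U \ S) κ} {hne : (R.part none).Nonempty}
  {hadj : ∀ s ∈ S, ∀ v ∈ U \ S, G.Adj s v → v ∈ R.part none}

theorem part_addRoot_none (hSU : S ⊆ U) : (R.addRoot hne hadj).part none = S := by
  ext v
  simpa [mem_part, addRoot] using @hSU v

theorem part_addRoot_some (x : Option κ) : (R.addRoot hne hadj).part (some x) = R.part x := by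
  ext v
  by_cases hv : v ∈ S <;> simp [mem_part, addRoot, hv]

theorem children_addRoot_none : (R.addRoot hne hadj).children none = {none} := by
  ext (_ | x) <;> simp [children, addRoot]

theorem ncard_children_addRoot_some [Finite κ] (x : Option κ) :
    ((R.addRoot hne hadj).children (some x)).ncard ≤ (R.children x).ncard := by
  refine (Set.ncard_le_ncard (t := some '' R.children x) ?_).trans
    (Set.ncard_image_le (Set.toFinite _))
  rintro (_ | y) hy
  · simp [children, addRoot] at hy
  · exact ⟨y, by simpa [children, addRoot] using hy, rfl⟩

end AddRoot

/-- The parent function on the non-root nodes of two trees glued at their roots. -/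
def glueParent (p₁ : κ₁ → Option κ₁) (p₂ : κ₂ → Option κ₂) : κ₁ ⊕ κ₂ → Option (κ₁ ⊕ κ₂) :=
  Sum.elim (fun x => (p₁ x).map Sum.inl) fun x => (p₂ x).map Sum.inr

/-- Gluing partitions of `X ∪ P` and `X ∪ Q` at their roots, whose parts both contain `X`. -/
noncomputable def glue (R₁ : RootedTreePartition G (X ∪ P) κ₁)
    (R₂ : RootedTreePartition G (X ∪ Q) κ₂) (h₁ : X ⊆ R₁.part none) (h₂ : X ⊆ R₂.part none)
    (hPQ : Disjoint P Q) (hadj : ∀ u ∈ P, ∀ v ∈ Q, ¬ G.Adj u v) :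
    RootedTreePartition G (X ∪ P ∪ Q) (κ₁ ⊕ κ₂) where
  parent := glueParent R₁.parent R₂.parent
  height := Sum.elim R₁.height R₂.height
  label v := if v ∈ X ∪ P then (R₁.label v).map Sum.inl else (R₂.label v).map Sum.inr
  height_lt x y h := by
    rcases x with x | x <;> rcases y with y | y <;>
      simp only [glueParent, Sum.elim_inl, Sum.elim_inr, Option.map_eq_some_iff, Sum.inl.injEq,
        Sum.inr.injEq, exists_eq_right, reduceCtorEq, and_false, exists_false] at h
    · exact R₁.height_lt x y h
    · exact R₂.height_lt x y h
  label_surj x := by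
    rcases x with x | x
    · obtain ⟨v, hv, hx⟩ := R₁.label_surj x
      exact ⟨v, Finset.mem_union_left _ hv, by simp only [if_pos hv, hx, Option.map_some]⟩
    · obtain ⟨v, hv, hx⟩ := R₂.label_surj x
      have hvX : v ∉ X := fun h => by simpa [hx] using (mem_part.1 (h₂ h)).2
      have hvQ : v ∈ Q := (Finset.mem_union.1 hv).resolve_left hvX
      have hvP : v ∉ X ∪ P := fun h => Finset.disjoint_left.1 hPQ
        ((Finset.mem_union.1 h).resolve_left hvX) hvQ
      exact ⟨v, Finset.mem_union_right _ hvQ, by simp only [if_neg hvP, hx, Option.map_some]⟩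
  label_adj := by
    have hlab : ∀ v ∈ X ∪ Q, (if v ∈ X ∪ P then (R₁.label v).map Sum.inl
        else (R₂.label v).map Sum.inr : Option (κ₁ ⊕ κ₂)) = (R₂.label v).map Sum.inr := by
      intro v hv
      split_ifs with h
      · have hvX : v ∈ X := by
          by_contra hvX
          exact Finset.disjoint_left.1 hPQ ((Finset.mem_union.1 h).resolve_left hvX)
            ((Finset.mem_union.1 hv).resolve_left hvX)
        rw [(mem_part.1 (h₁ hvX)).2, (mem_part.1 (h₂ hvX)).2]
        rfl
      · rfl
    intro u hu v hv huv
    have hcases : (u ∈ X ∪ P ∧ v ∈ X ∪ P) ∨ (u ∈ X ∪ Q ∧ v ∈ X ∪ Q) := by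
      have h3 := hadj u
      have h4 := fun h : v ∈ P => hadj v h u
      simp only [Finset.mem_union] at hu hv ⊢
      have := huv.symm
      tauto
    rcases hcases with ⟨hu, hv⟩ | ⟨hu, hv⟩
    · rw [if_pos hu, if_pos hv]
      rcases R₁.label_adj u hu v hv huv with h | ⟨x, h1, h2⟩ | ⟨x, h1, h2⟩
      · exact Or.inl (by rw [h])
      · exact Or.inr (Or.inl ⟨Sum.inl x, by simp [h1], by simp [glueParent, h2]⟩)
      · exact Or.inr (Or.inr ⟨Sum.inl x, by simp [h1], by simp [glueParent, h2]⟩)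
    · rw [hlab u hu, hlab v hv]
      rcases R₂.label_adj u hu v hv huv with h | ⟨x, h1, h2⟩ | ⟨x, h1, h2⟩
      · exact Or.inl (by rw [h])
      · exact Or.inr (Or.inl ⟨Sum.inr x, by simp [h1], by simp [glueParent, h2]⟩)
      · exact Or.inr (Or.inr ⟨Sum.inr x, by simp [h1], by simp [glueParent, h2]⟩)

section Glue

variable {R₁ : RootedTreePartition G (X ∪ P) κ₁} {R₂ : RootedTreePartition G (X ∪ Q) κ₂}
  {h₁ : X ⊆ R₁.part none} {h₂ : X ⊆ R₂.part none} {hPQ : Disjoint P Q}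
  {hadj : ∀ u ∈ P, ∀ v ∈ Q, ¬ G.Adj u v}

theorem part_glue_none :
    (R₁.glue R₂ h₁ h₂ hPQ hadj).part none = R₁.part none ∪ R₂.part none := by
  ext v
  have h3 := @h₁ v
  have h4 := @h₂ v
  have h5 : v ∈ P → v ∉ Q := fun h => Finset.disjoint_left.1 hPQ h
  by_cases hX : v ∈ X <;> by_cases hP : v ∈ P <;> by_cases hQ : v ∈ Q <;>
    simp_all [mem_part, glue]

theorem part_glue_inl (x : κ₁) :
    (R₁.glue R₂ h₁ h₂ hPQ hadj).part (some (Sum.inl x)) ⊆ R₁.part (some x) := by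
  intro v hv
  by_cases h : v ∈ X ∪ P
  · have := (mem_part.1 hv).2
    simp only [glue, if_pos h, Option.map_eq_some_iff, Sum.inl.injEq, exists_eq_right] at this
    exact mem_part.2 ⟨h, this⟩
  · have := (mem_part.1 hv).2
    simp only [glue, if_neg h] at this
    simp at this

theorem part_glue_inr (x : κ₂) :
    (R₁.glue R₂ h₁ h₂ hPQ hadj).part (some (Sum.inr x)) ⊆ R₂.part (some x) := by
  intro v hv
  by_cases h : v ∈ X ∪ P
  · have := (mem_part.1 hv).2
    simp only [glue, if_pos h] at this
    simp at this
  · have hvU := (mem_part.1 hv).1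
    have := (mem_part.1 hv).2
    simp only [glue, if_neg h, Option.map_eq_some_iff, Sum.inr.injEq, exists_eq_right] at this
    exact mem_part.2 ⟨Finset.mem_union_right _ ((Finset.mem_union.1 hvU).resolve_left h), this⟩

theorem ncard_children_glue_none [Finite κ₁] [Finite κ₂] :
    ((R₁.glue R₂ h₁ h₂ hPQ hadj).children none).ncard ≤
      (R₁.children none).ncard + (R₂.children none).ncard := by
  refine (Set.ncard_le_ncard
    (t := Sum.inl '' R₁.children none ∪ Sum.inr '' R₂.children none) ?_).trans
    ((Set.ncard_union_le _ _).trans (Nat.add_le_add (Set.ncard_image_le (Set.toFinite _))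
      (Set.ncard_image_le (Set.toFinite _))))
  rintro (y | y) hy <;> simpa [children, glue, glueParent] using hy

theorem ncard_children_glue_inl [Finite κ₁] [Finite κ₂] (x : κ₁) :
    ((R₁.glue R₂ h₁ h₂ hPQ hadj).children (some (Sum.inl x))).ncard ≤
      (R₁.children (some x)).ncard := by
  refine (Set.ncard_le_ncard (t := Sum.inl '' R₁.children (some x)) ?_).trans
    (Set.ncard_image_le (Set.toFinite _))
  rintro (y | y) hy
  · simpa [children, glue, glueParent] using hy
  · simp [children, glue, glueParent] at hy

theorem ncard_children_glue_inr [Finite κ₁] [Finite κ₂] (x : κ₂) :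
    ((R₁.glue R₂ h₁ h₂ hPQ hadj).children (some (Sum.inr x))).ncard ≤
      (R₂.children (some x)).ncard := by
  refine (Set.ncard_le_ncard (t := Sum.inr '' R₂.children (some x)) ?_).trans
    (Set.ncard_image_le (Set.toFinite _))
  rintro (y | y) hy
  · simp [children, glue, glueParent] at hy
  · simpa [children, glue, glueParent] using hy

end Glue

end RootedTreePartition

open Classical in
theorem card_boundary_le {V : Type} [Fintype V] {G : SimpleGraph V} {d : ℕ}
    (hd : ∀ v, (G.neighborSet v).ncard ≤ d) (S W : Finset V) :
    (W.filter fun v => ∃ s ∈ S, G.Adj s v).card ≤ S.card * d := by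
  refine (Finset.card_le_card (t := S.biUnion fun s => (G.neighborSet s).toFinset)
    fun v hv => ?_).trans (Finset.card_biUnion_le_card_mul _ _ _ fun s _ => ?_)
  · obtain ⟨-, s, hs, hsv⟩ := Finset.mem_filter.1 hv
    exact Finset.mem_biUnion.2 ⟨s, hs, Set.mem_toFinset.2 hsv⟩
  · rw [← Set.ncard_eq_toFinset_card']
    exact hd s

/-- The maximum width of a part in the construction, in terms of `q = √2`. -/
def widthBound (q k d : ℝ) : ℝ :=
  (1 + q) * k * (3 * (1 + q) * d - 1)

/-- The maximum degree of the tree in the construction, in terms of `q = √2`. -/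
def degreeBound (q d : ℝ) : ℝ :=
  (3 + 3 * q) * d - 3 * (q - 1)

section Bounds

variable {q k d s : ℝ}

theorem root_width_le (hq : q ^ 2 = 2) (hq1 : 1 ≤ q) (hk : 1 ≤ k) (hd : 1 ≤ d)
    (hs : s ≤ (4 + 3 * q) * k * d) :
    (1 + q / 2) * s - (1 + q) * k ≤ widthBound q k d := by
  have h1 : (1 + q / 2) * s ≤ (1 + q / 2) * ((4 + 3 * q) * k * d) :=
    mul_le_mul_of_nonneg_left hs (by linarith)
  have h2 : (1 + q / 2) * ((4 + 3 * q) * k * d) = (7 + 5 * q) * (k * d) := by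
    linear_combination 3 / 2 * k * d * hq
  have h3 : widthBound q k d = (9 + 6 * q) * (k * d) - (1 + q) * k := by
    unfold widthBound
    linear_combination 3 * k * d * hq
  have h4 : 0 ≤ k * d := by positivity
  nlinarith

theorem root_degree_le (hq : q ^ 2 = 2) (hq1 : 1 ≤ q) (hq2 : q ≤ 2) (hk : 1 ≤ k) (hd : 1 ≤ d)
    (hs : s ≤ (4 + 3 * q) * k * d) {c : ℝ} (hc : q * k * c ≤ s - 2 * k) :
    c + 1 ≤ degreeBound q d := by
  have h1 : q * c ≤ (4 + 3 * q) * d - 2 := by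
    have : k * (q * c) ≤ k * ((4 + 3 * q) * d - 2) := by linarith
    exact le_of_mul_le_mul_left this (by linarith)
  have h2 : q * (q * c) ≤ q * ((4 + 3 * q) * d - 2) := mul_le_mul_of_nonneg_left h1 (by linarith)
  have h3 : q * (q * c) = 2 * c := by linear_combination c * hq
  have h4 : q * ((4 + 3 * q) * d - 2) = (4 * q + 6) * d - 2 * q := by
    linear_combination 3 * d * hq
  have h5 : q * 1 ≤ q * d := mul_le_mul_of_nonneg_left hd (by linarith)
  unfold degreeBound
  linarith

end Bounds

open Classical in
/-- The inductive construction: a partition of `U` whose root part contains a prescribed set `S`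
and is controlled by the size of `S`. -/
theorem exists_rootedTreePartition {V ι : Type} [Fintype V] [Fintype ι] {G : SimpleGraph V}
    {T : SimpleGraph ι} {B : ι → Set V} (hB : IsTreeDecomp G T B) {k d : ℕ} (hk : 1 ≤ k)
    (hd : 1 ≤ d) (hcard : ∀ x, (B x).ncard ≤ k) (hdeg : ∀ v, (G.neighborSet v).ncard ≤ d)
    {q : ℝ} (hq : q ^ 2 = 2) (hq1 : 1 ≤ q) (hq2 : q ≤ 2) (n : ℕ) :
    ∀ U S : Finset V, U.card = n → S ⊆ U → (2 + q) * k ≤ S.card →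
      (S.card : ℝ) ≤ (4 + 3 * q) * k * d →
      ∃ (κ : Type) (_ : Finite κ) (R : RootedTreePartition G U κ), S ⊆ R.part none ∧
        ((R.part none).card : ℝ) ≤ (1 + q / 2) * S.card - (1 + q) * k ∧
        q * k * (R.children none).ncard ≤ S.card - 2 * k ∧
        ∀ x, ((R.part (some x)).card : ℝ) ≤ widthBound q k d ∧
          ((R.children (some x)).ncard : ℝ) + 1 ≤ degreeBound q d := by
  have hkR : (1 : ℝ) ≤ k := by exact_mod_cast hk
  have hdR : (1 : ℝ) ≤ d := by exact_mod_cast hd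
  have hkd : (k : ℝ) * 1 ≤ k * d := mul_le_mul_of_nonneg_left hdR (by linarith)
  have hqk : (1 : ℝ) * k ≤ q * k := mul_le_mul_of_nonneg_right hq1 (by linarith)
  have hqkd : q * (k * 1) ≤ q * (k * d) := mul_le_mul_of_nonneg_left hkd (by linarith)
  have hstart : ∀ s : ℝ, (2 + q) * k ≤ s → s ≤ (1 + q / 2) * s - (1 + q) * k := by
    intro s hs
    have h1 : q * ((2 + q) * k) ≤ q * s := mul_le_mul_of_nonneg_left hs (by linarith)
    have h2 : q * ((2 + q) * k) = (2 * q + 2) * k := by linear_combination k * hq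
    linarith
  induction n using Nat.strong_induction_on with
  | _ n ih =>
  intro U S hUn hSU hSlo hShi
  by_cases hlarge : (4 + 3 * q) * k < (S.card : ℝ)
  · have h4 : 4 * k ≤ S.card := by
      have : (4 : ℝ) * k ≤ S.card := by linarith
      exact_mod_cast this
    obtain ⟨X, P, Q, hXk, hU, hXP, hXQ, hPQ, hadj, hP, hQ⟩ :=
      hB.exists_separation hk hcard hSU h4
    subst hU
    have hP0 : 0 < P.card := by
      have := Finset.card_le_card (Finset.inter_subset_right (s₁ := S) (s₂ := P))
      omega
    have hQ0 : 0 < Q.card := by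
      have := Finset.card_le_card (Finset.inter_subset_right (s₁ := S) (s₂ := Q))
      omega
    have hPQS : (S ∩ P).card + (S ∩ Q).card ≤ S.card := by
      rw [← Finset.card_union_of_disjoint (Finset.disjoint_of_subset_left
        Finset.inter_subset_right (Finset.disjoint_of_subset_right Finset.inter_subset_right hPQ))]
      exact Finset.card_le_card
        (Finset.union_subset Finset.inter_subset_left Finset.inter_subset_left)
    have hcU : (X ∪ P ∪ Q).card = X.card + P.card + Q.card := by
      rw [Finset.card_union_of_disjoint (Finset.disjoint_union_left.2 ⟨hXQ, hPQ⟩),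
        Finset.card_union_of_disjoint hXP]
    have hcS₁ : (X ∪ S ∩ P).card = k + (S ∩ P).card := by
      rw [Finset.card_union_of_disjoint
        (Finset.disjoint_of_subset_right Finset.inter_subset_right hXP), hXk]
    have hcS₂ : (X ∪ S ∩ Q).card = k + (S ∩ Q).card := by
      rw [Finset.card_union_of_disjoint
        (Finset.disjoint_of_subset_right Finset.inter_subset_right hXQ), hXk]
    have hPR : (S.card : ℝ) ≤ 3 * (S ∩ P).card + k := by exact_mod_cast hP
    have hQR : (S.card : ℝ) ≤ 3 * (S ∩ Q).card + k := by exact_mod_cast hQ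
    have hPQR : ((S ∩ P).card : ℝ) + (S ∩ Q).card ≤ S.card := by exact_mod_cast hPQS
    obtain ⟨κ₁, _, R₁, hS₁, hw₁, hc₁, hx₁⟩ := ih (X ∪ P).card
      (by rw [← hUn, hcU, Finset.card_union_of_disjoint hXP]; omega) (X ∪ P) (X ∪ S ∩ P) rfl
      (Finset.union_subset_union_right Finset.inter_subset_right)
      (by rw [hcS₁]; push_cast; linarith) (by rw [hcS₁]; push_cast; linarith)
    obtain ⟨κ₂, _, R₂, hS₂, hw₂, hc₂, hx₂⟩ := ih (X ∪ Q).card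
      (by rw [← hUn, hcU, Finset.card_union_of_disjoint hXQ]; omega) (X ∪ Q) (X ∪ S ∩ Q) rfl
      (Finset.union_subset_union_right Finset.inter_subset_right)
      (by rw [hcS₂]; push_cast; linarith) (by rw [hcS₂]; push_cast; linarith)
    rw [hcS₁] at hw₁ hc₁
    rw [hcS₂] at hw₂ hc₂
    push_cast at hw₁ hc₁ hw₂ hc₂
    have hX₁ := Finset.union_subset_left hS₁
    have hX₂ := Finset.union_subset_left hS₂
    refine ⟨κ₁ ⊕ κ₂, inferInstance, R₁.glue R₂ hX₁ hX₂ hPQ hadj, ?_, ?_, ?_, ?_⟩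
    · rw [RootedTreePartition.part_glue_none]
      intro v hv
      have h1 := @hS₁ v
      have h2 := @hS₂ v
      have h3 := hSU hv
      simp only [Finset.mem_union, Finset.mem_inter] at *
      tauto
    · rw [RootedTreePartition.part_glue_none]
      have hinter : k ≤ (R₁.part none ∩ R₂.part none).card :=
        hXk ▸ Finset.card_le_card (Finset.subset_inter hX₁ hX₂)
      have hsum := Finset.card_union_add_card_inter (R₁.part none) (R₂.part none)
      have hsumR : ((R₁.part none ∪ R₂.part none).card : ℝ) + k ≤
          (R₁.part none).card + (R₂.part none).card := by
        have : (R₁.part none ∪ R₂.part none).card + k ≤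
          (R₁.part none).card + (R₂.part none).card := by omega
        exact_mod_cast this
      have hmul : (1 + q / 2) * (((S ∩ P).card : ℝ) + (S ∩ Q).card) ≤ (1 + q / 2) * S.card :=
        mul_le_mul_of_nonneg_left hPQR (by linarith)
      linarith
    · have hch : (((R₁.glue R₂ hX₁ hX₂ hPQ hadj).children none).ncard : ℝ) ≤
          (R₁.children none).ncard + (R₂.children none).ncard := by
        exact_mod_cast RootedTreePartition.ncard_children_glue_none
      have := mul_le_mul_of_nonneg_left hch (by linarith : 0 ≤ q * k)
      linarith
    · rintro (x | x)
      · refine ⟨le_trans ?_ (hx₁ x).1, le_trans ?_ (hx₁ x).2⟩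
        · exact_mod_cast Finset.card_le_card (RootedTreePartition.part_glue_inl x)
        · exact_mod_cast Nat.add_le_add_right
            (RootedTreePartition.ncard_children_glue_inl x) 1
      · refine ⟨le_trans ?_ (hx₂ x).1, le_trans ?_ (hx₂ x).2⟩
        · exact_mod_cast Finset.card_le_card (RootedTreePartition.part_glue_inr x)
        · exact_mod_cast Nat.add_le_add_right
            (RootedTreePartition.ncard_children_glue_inr x) 1
  push Not at hlarge
  suffices hroot : S = U ∨ ∃ (κ : Type) (_ : Finite κ) (R : RootedTreePartition G (U \ S) κ),
      (R.part none).Nonempty ∧ (∀ s ∈ S, ∀ v ∈ U \ S, G.Adj s v → v ∈ R.part none) ∧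
      ∀ a, ((R.part a).card : ℝ) ≤ widthBound q k d ∧
        ((R.children a).ncard : ℝ) + 1 ≤ degreeBound q d by
    rcases hroot with rfl | ⟨κ, _, R, hne, hadj, hR⟩
    · refine ⟨Empty, inferInstance, RootedTreePartition.single G S, ?_, ?_, ?_, Empty.rec⟩
      · rw [RootedTreePartition.part_single]
      · rw [RootedTreePartition.part_single]
        exact hstart _ hSlo
      · rw [Set.eq_empty_of_isEmpty (RootedTreePartition.children _ _)]
        simp only [Set.ncard_empty, Nat.cast_zero, mul_zero]
        linarith
    · refine ⟨Option κ, inferInstance, R.addRoot hne hadj, ?_, ?_, ?_, fun x => ?_⟩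
      · rw [RootedTreePartition.part_addRoot_none hSU]
      · rw [RootedTreePartition.part_addRoot_none hSU]
        exact hstart _ hSlo
      · rw [RootedTreePartition.children_addRoot_none, Set.ncard_singleton]
        push_cast
        linarith
      · rw [RootedTreePartition.part_addRoot_some]
        refine ⟨(hR x).1, le_trans ?_ (hR x).2⟩
        exact_mod_cast Nat.add_le_add_right
          (RootedTreePartition.ncard_children_addRoot_some x) 1
  by_cases hSU' : S = U
  · exact Or.inl hSU'
  refine Or.inr ?_
  have hne : (U \ S).Nonempty := Finset.sdiff_nonempty.2 fun h => hSU' (hSU.antisymm h)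
  have hcap : ((2 + q) * k : ℝ) + 1 ≤ (4 + 3 * q) * k * d := by linarith
  by_cases hsmall : (U \ S).card < ⌈(2 + q) * (k : ℝ)⌉₊
  · rw [Nat.lt_ceil] at hsmall
    refine ⟨Empty, inferInstance, RootedTreePartition.single G (U \ S), ?_, ?_, ?_⟩
    · rwa [RootedTreePartition.part_single]
    · rw [RootedTreePartition.part_single]
      exact fun _ _ v hv _ => hv
    · rintro (_ | x)
      · rw [RootedTreePartition.part_single,
          Set.eq_empty_of_isEmpty (RootedTreePartition.children _ _)]
        refine ⟨hsmall.le.trans ((hstart _ le_rfl).trans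
          (root_width_le hq hq1 hkR hdR (by linarith))), ?_⟩
        exact root_degree_le hq hq1 hq2 hkR hdR hShi
          (by simp only [Set.ncard_empty, Nat.cast_zero, mul_zero]; linarith)
      · exact x.elim
  · push Not at hsmall
    set N : Finset V := (U \ S).filter fun v => ∃ s ∈ S, G.Adj s v
    have hNcard : (N.card : ℝ) ≤ S.card * d := by exact_mod_cast card_boundary_le hdeg S (U \ S)
    have hNhi : (N.card : ℝ) ≤ (4 + 3 * q) * k * d :=
      hNcard.trans (mul_le_mul_of_nonneg_right hlarge (by linarith))
    obtain ⟨S', hNS', hS'U, hS'⟩ := Finset.exists_subsuperset_card_eq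
      (Finset.filter_subset _ _ : N ⊆ U \ S) (le_max_left N.card ⌈(2 + q) * (k : ℝ)⌉₊)
      (max_le (Finset.card_le_card (Finset.filter_subset _ _)) hsmall)
    have hS'lo : (2 + q) * k ≤ (S'.card : ℝ) := by
      rw [hS', Nat.cast_max]
      exact (Nat.le_ceil _).trans (le_max_right _ _)
    have hS'hi : (S'.card : ℝ) ≤ (4 + 3 * q) * k * d := by
      rw [hS', Nat.cast_max]
      refine max_le hNhi ((Nat.ceil_lt_add_one ?_).le.trans hcap)
      positivity
    have hS0 : 0 < S.card := by
      have : (0 : ℝ) < S.card := by linarith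
      exact_mod_cast this
    have hlt : (U \ S).card < n := by
      have := Finset.card_sdiff_add_card_eq_card hSU
      omega
    obtain ⟨κ, _, R, hSR, hw, hc, hx⟩ := ih _ hlt (U \ S) S' rfl hS'U hS'lo hS'hi
    refine ⟨κ, inferInstance, R, ?_, ?_, ?_⟩
    · have : (0 : ℝ) < S'.card := by linarith
      exact (Finset.card_pos.1 (by exact_mod_cast this)).mono hSR
    · exact fun s hs v hv hsv => hSR (hNS' (Finset.mem_filter.2 ⟨hv, s, hs, hsv⟩))
    · rintro (_ | x)
      · exact ⟨hw.trans (root_width_le hq hq1 hkR hdR hS'hi),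
          root_degree_le hq hq1 hq2 hkR hdR hS'hi hc⟩
      · exact hx x

theorem exists_isTreeDecomp_treewidth {V : Type} [Fintype V] (G : SimpleGraph V) :
    ∃ (ι : Type) (_ : Fintype ι) (T : SimpleGraph ι) (B : ι → Set V),
      IsTreeDecomp G T B ∧ ∀ x, (B x).ncard ≤ treewidth G + 1 := by
  refine Nat.sInf_mem (s := {k | ∃ (ι : Type) (_ : Fintype ι) (T : SimpleGraph ι)
    (B : ι → Set V), IsTreeDecomp G T B ∧ ∀ x, (B x).ncard ≤ k + 1})
    ⟨Nat.card V, Unit, inferInstance, ⊥, fun _ => Set.univ, ⟨?_, ?_, ?_⟩, ?_⟩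
  · exact IsTree.of_subsingleton
  · exact fun u v _ => ⟨(), trivial, trivial⟩
  · intro v
    have : Nonempty {x : Unit | v ∈ (Set.univ : Set V)} := ⟨⟨(), trivial⟩⟩
    exact ⟨Preconnected.of_subsingleton⟩
  · intro x
    rw [Set.ncard_univ]
    omega

theorem ncard_neighborSet_le_maxDeg {V : Type} [Fintype V] (G : SimpleGraph V) (v : V) :
    (G.neighborSet v).ncard ≤ maxDeg G :=
  le_csSup (Set.finite_range _).bddAbove ⟨v, rfl⟩

theorem one_le_maxDeg {V : Type} [Fintype V] {G : SimpleGraph V} (hG : G.edgeSet.Nonempty) :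
    1 ≤ maxDeg G := by
  obtain ⟨e, he⟩ := hG
  induction e with
  | _ a b =>
    refine le_trans ?_ (ncard_neighborSet_le_maxDeg G a)
    exact (Set.ncard_pos (Set.toFinite _)).2 ⟨b, he⟩

/-- Every non-trivial graph `G` has a `T`-partition of width at most
`(1+√2)·(tw(G)+1)·(3·(1+√2)·Δ(G) − 1)` for some tree `T` with
`Δ(T) ≤ (3+3√2)·Δ(G) − 3·(√2 − 1)`. -/
theorem exists_treePartition_sqrt_two {V : Type} [Fintype V] (G : SimpleGraph V)
    (hG : G.edgeSet.Nonempty) :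
    ∃ (ι : Type) (_ : Fintype ι) (T : SimpleGraph ι) (B : ι → Set V),
      IsTreePartition G T B ∧
      (∀ x, ((B x).ncard : ℝ) ≤
        (1 + Real.sqrt 2) * (treewidth G + 1) * (3 * (1 + Real.sqrt 2) * maxDeg G - 1)) ∧
      (∀ x, ((T.neighborSet x).ncard : ℝ) ≤
        (3 + 3 * Real.sqrt 2) * maxDeg G - 3 * (Real.sqrt 2 - 1)) := by
  set q := Real.sqrt 2
  have hq : q ^ 2 = 2 := Real.sq_sqrt (by norm_num)
  have hq1 : 1 ≤ q := Real.one_le_sqrt.2 (by norm_num)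
  have hq2 : q ≤ 2 := by nlinarith
  have hd := one_le_maxDeg hG
  have hdR : (1 : ℝ) ≤ maxDeg G := by exact_mod_cast hd
  have hdeg := ncard_neighborSet_le_maxDeg G
  obtain ⟨ι, _, T, B, hB, hcard⟩ := exists_isTreeDecomp_treewidth G
  have hk : 1 ≤ treewidth G + 1 := by omega
  have hkcast : ((treewidth G + 1 : ℕ) : ℝ) = treewidth G + 1 := by push_cast; rfl
  set k := treewidth G + 1
  rw [← hkcast]
  have hkR : (1 : ℝ) ≤ k := by exact_mod_cast hk
  have hkd : (k : ℝ) * 1 ≤ k * maxDeg G := mul_le_mul_of_nonneg_left hdR (by linarith)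
  have hqk : (1 : ℝ) * k ≤ q * k := mul_le_mul_of_nonneg_right hq1 (by linarith)
  have hqkd : q * (k * 1) ≤ q * (k * maxDeg G) := mul_le_mul_of_nonneg_left hkd (by linarith)
  have hcap : ((2 + q) * k : ℝ) + 1 ≤ (4 + 3 * q) * k * maxDeg G := by linarith
  suffices h : ∃ (κ : Type) (_ : Finite κ) (R : RootedTreePartition G Finset.univ κ),
      (R.part none).Nonempty ∧ (∀ a, ((R.part a).card : ℝ) ≤ widthBound q k (maxDeg G)) ∧
      ((R.children none).ncard : ℝ) ≤ degreeBound q (maxDeg G) ∧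
      ∀ x, ((R.children (some x)).ncard : ℝ) + 1 ≤ degreeBound q (maxDeg G) by
    obtain ⟨κ, hκ, R, hne, hw, hroot, hx⟩ := h
    refine ⟨Option κ, Fintype.ofFinite _, parentGraph R.parent, fun a => (R.part a : Set V),
      R.isTreePartition hne, fun a => ?_, ?_⟩
    · rw [Set.ncard_coe_finset]
      exact hw a
    · rintro (_ | x)
      · exact le_trans (by exact_mod_cast ncard_neighborSet_none) hroot
      · exact le_trans (by exact_mod_cast ncard_neighborSet_some x) (hx x)
  by_cases hsmall : (Finset.univ : Finset V).card < ⌈(2 + q) * (k : ℝ)⌉₊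
  · rw [Nat.lt_ceil] at hsmall
    obtain ⟨e, -⟩ := hG
    have hc : (0 : ℝ) + 1 ≤ degreeBound q (maxDeg G) :=
      root_degree_le hq hq1 hq2 hkR hdR (s := (2 + q) * k) (by linarith) (by linarith)
    refine ⟨Empty, inferInstance, RootedTreePartition.single G Finset.univ, ?_, ?_, ?_,
      Empty.rec⟩
    · rw [RootedTreePartition.part_single]
      exact ⟨e.out.1, Finset.mem_univ _⟩
    · rintro (_ | x)
      · rw [RootedTreePartition.part_single]
        have hs : (2 + q) * (k : ℝ) = (1 + q / 2) * ((2 + q) * k) - (1 + q) * k := by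
          linear_combination (-k / 2 : ℝ) * hq
        exact hsmall.le.trans (hs.le.trans (root_width_le hq hq1 hkR hdR (by linarith)))
      · exact x.elim
    · rw [Set.eq_empty_of_isEmpty (RootedTreePartition.children _ _)]
      simp only [Set.ncard_empty, Nat.cast_zero]
      linarith
  · push Not at hsmall
    obtain ⟨S, hSU, hS⟩ := Finset.exists_subset_card_eq hsmall
    have hSlo : (2 + q) * k ≤ (S.card : ℝ) := hS ▸ Nat.le_ceil _
    have hShi : (S.card : ℝ) ≤ (4 + 3 * q) * k * maxDeg G := by
      rw [hS]
      exact (Nat.ceil_lt_add_one (by positivity)).le.trans hcap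
    obtain ⟨κ, hκ, R, hSR, hw, hc, hx⟩ := exists_rootedTreePartition hB hk hd hcard hdeg hq hq1 hq2
      _ Finset.univ S rfl hSU hSlo hShi
    refine ⟨κ, hκ, R, ?_, ?_, ?_, fun x => (hx x).2⟩
    · have : (0 : ℝ) < S.card := by linarith
      exact (Finset.card_pos.1 (by exact_mod_cast this)).mono hSR
    · rintro (_ | x)
      · exact hw.trans (root_width_le hq hq1 hkR hdR hShi)
      · exact (hx x).1
    · have := root_degree_le hq hq1 hq2 hkR hdR hShi hc
      linarith
end

section
/- Let Δ ≥ 4 and d ≥ 1 be integers. For every tree T with maximum degree at most Δ − 1 and every T-partition (B_u : u ∈ V(T)) of the complete tree X_{Δ,d}, there exists a node u ∈ V(T) with |B_u| ≥ |V(X_{Δ,d})| / (3·(Δ−2)^d). -/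
open SimpleGraph

/-- `X` is the complete tree `X_{Δ,d}` with root `r`: a tree in which every leaf
(vertex of degree `1`) is at distance exactly `d` from `r` and every non-leaf vertex has
degree `Δ`. -/
def IsCompleteTree {κ : Type*} [Fintype κ] (Δ d : ℕ) (X : SimpleGraph κ) (r : κ) : Prop :=
  X.IsTree ∧
  (∀ v, (X.neighborSet v).ncard = 1 → X.dist r v = d) ∧
  (∀ v, (X.neighborSet v).ncard ≠ 1 → (X.neighborSet v).ncard = Δ)

/-- In a tree, a vertex has at most one neighbour closer to a given vertex. -/
theorem SimpleGraph.IsTree.eq_of_adj_of_dist_lt {V : Type*} {G : SimpleGraph V} (hG : G.IsTree)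
    {r v w₁ w₂ : V} (h₁ : G.Adj w₁ v) (h₂ : G.Adj w₂ v)
    (hd₁ : G.dist r w₁ < G.dist r v) (hd₂ : G.dist r w₂ < G.dist r v) : w₁ = w₂ := by
  have key : ∀ w, G.Adj w v → G.dist r w < G.dist r v →
      ∃ p : G.Walk r v, p.IsPath ∧ p.penultimate = w := by
    intro w hw hlt
    obtain ⟨p, hp⟩ := hG.connected.exists_walk_length_eq_dist r w
    refine ⟨p.concat hw, Walk.isPath_of_length_eq_dist _ ?_, by simp⟩
    have hle := dist_le (p.concat hw)
    rw [Walk.length_concat] at hle ⊢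
    omega
  obtain ⟨p, hp, rfl⟩ := key w₁ h₁ hd₁
  obtain ⟨q, hq, rfl⟩ := key w₂ h₂ hd₂
  rw [(hG.existsUnique_path r v).unique hp hq]

/-- Every vertex of the complete tree `X_{Δ,d}` is at distance at most `d` from the root. -/
theorem IsCompleteTree.dist_le {κ : Type*} [Fintype κ] {Δ d : ℕ} (hΔ : 2 ≤ Δ)
    {X : SimpleGraph κ} {r : κ} (hX : IsCompleteTree Δ d X r) (v : κ) : X.dist r v ≤ d := by
  obtain ⟨hT, hleaf, hdeg⟩ := hX
  have : Nonempty κ := ⟨r⟩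
  obtain ⟨m, hm⟩ := Finite.exists_max (X.dist r)
  refine (hm v).trans ?_
  by_cases h : (X.neighborSet m).ncard = 1
  · exact (hleaf m h).le
  · have hle : (X.neighborSet m).ncard ≤ 1 := by
      rw [Set.ncard_le_one_iff]
      intro a b ha hb
      exact hT.eq_of_adj_of_dist_lt ha.symm hb.symm
        (lt_of_le_of_ne (hm a) (hT.dist_ne_of_adj r ha).symm)
        (lt_of_le_of_ne (hm b) (hT.dist_ne_of_adj r hb).symm)
    have := hdeg m h
    omega

/-- A map sending adjacent vertices to equal or adjacent vertices does not increase distances. -/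
theorem SimpleGraph.Connected.dist_map_le {V W : Type*} {G : SimpleGraph V} {H : SimpleGraph W}
    (hG : G.Connected) (hH : H.Connected) (f : V → W)
    (hf : ∀ ⦃v w⦄, G.Adj v w → f v = f w ∨ H.Adj (f v) (f w)) (u v : V) :
    H.dist (f u) (f v) ≤ G.dist u v := by
  have key : ∀ {a b : V} (p : G.Walk a b), H.dist (f a) (f b) ≤ p.length := by
    intro a b p
    induction p with
    | nil => simp
    | @cons a b c hab p ih =>
      rw [Walk.length_cons]
      have htri := hH.dist_triangle (u := f a) (v := f b) (w := f c)
      have hone : H.dist (f a) (f b) ≤ 1 := by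
        rcases hf hab with h | h
        · simp [h]
        · exact (dist_eq_one_iff_adj.2 h).le
      omega
  obtain ⟨p, hp⟩ := hG.exists_walk_length_eq_dist u v
  exact hp ▸ key p

/-- The last step of a shortest walk: a vertex at distance `n + 1` has a neighbour at distance
`n`. -/
theorem SimpleGraph.Connected.exists_adj_dist_eq {V : Type*} {G : SimpleGraph V}
    (hG : G.Connected) {x v : V} {n : ℕ} (h : G.dist x v = n + 1) :
    ∃ w, G.Adj w v ∧ G.dist x w = n := by
  obtain ⟨p, hp⟩ := hG.exists_walk_length_eq_dist x v
  have hnil : ¬ p.Nil := by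
    rw [← Walk.length_eq_zero_iff]
    omega
  have hadj := Walk.adj_penultimate hnil
  refine ⟨p.penultimate, hadj, ?_⟩
  have h₁ := G.dist_le p.dropLast
  have h₂ := hG.dist_triangle (u := x) (v := p.penultimate) (w := v)
  rw [dist_eq_one_iff_adj.2 hadj] at h₂
  simp only [Walk.dropLast, Walk.take_length] at h₁
  omega

/-- In a connected graph of maximum degree at most `D + 1`, there are at most `(D + 1) D ^ n`
vertices at distance `n + 1` from a given vertex. -/
theorem SimpleGraph.Connected.card_sphere_le {V : Type*} [Fintype V] {G : SimpleGraph V}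
    (hG : G.Connected) {D : ℕ} (hdeg : ∀ v, (G.neighborSet v).ncard ≤ D + 1) (x : V) (n : ℕ) :
    {v | G.dist x v = n + 1}.ncard ≤ (D + 1) * D ^ n := by
  classical
  induction n with
  | zero =>
    have : {v | G.dist x v = 0 + 1} = G.neighborSet x := by
      ext v
      simp [dist_eq_one_iff_adj]
    rw [this, pow_zero, mul_one]
    exact hdeg x
  | succ n ih =>
    have hcover : {v | G.dist x v = n + 1 + 1}.toFinset ⊆
        {v | G.dist x v = n + 1}.toFinset.biUnion
          fun w => {v | G.Adj w v ∧ G.dist x v = n + 1 + 1}.toFinset := by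
      intro v hv
      obtain ⟨w, hw, hd⟩ := hG.exists_adj_dist_eq (n := n + 1) (by simpa using hv)
      simp only [Finset.mem_biUnion, Set.mem_toFinset, Set.mem_ofPred_eq] at hv ⊢
      exact ⟨w, hd, hw, hv⟩
    have hchild : ∀ w ∈ {v | G.dist x v = n + 1}.toFinset,
        {v | G.Adj w v ∧ G.dist x v = n + 1 + 1}.toFinset.card ≤ D := by
      intro w hw
      obtain ⟨u, hu, hd⟩ := hG.exists_adj_dist_eq (n := n) (by simpa using hw)
      rw [← Set.ncard_eq_toFinset_card']
      have hss : {v | G.Adj w v ∧ G.dist x v = n + 1 + 1} ⊂ G.neighborSet w := by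
        refine ⟨fun v hv => hv.1, fun hsub => ?_⟩
        have := (hsub (show u ∈ G.neighborSet w from hu.symm)).2
        omega
      have := Set.ncard_lt_ncard hss
      have := hdeg w
      omega
    rw [Set.ncard_eq_toFinset_card'] at ih ⊢
    calc _ ≤ _ := Finset.card_le_card hcover
      _ ≤ _ := Finset.card_biUnion_le_card_mul _ _ D hchild
      _ ≤ (D + 1) * D ^ n * D := Nat.mul_le_mul_right D ih
      _ = (D + 1) * D ^ (n + 1) := by ring

/-- In a connected graph of maximum degree at most `D + 1`, where `D ≥ 2`, there are at most
`3 D ^ n - 2` vertices at distance at most `n` from a given vertex. -/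
theorem SimpleGraph.Connected.card_ball_le {V : Type*} [Fintype V] {G : SimpleGraph V}
    (hG : G.Connected) {D : ℕ} (hD : 2 ≤ D) (hdeg : ∀ v, (G.neighborSet v).ncard ≤ D + 1)
    (x : V) (n : ℕ) : {v | G.dist x v ≤ n}.ncard + 2 ≤ 3 * D ^ n := by
  induction n with
  | zero =>
    have : {v | G.dist x v ≤ 0} = {x} := by
      ext v
      simp only [Set.mem_ofPred_eq, Nat.le_zero, hG.dist_eq_zero_iff, Set.mem_singleton_iff,
        eq_comm]
    rw [this, Set.ncard_singleton, pow_zero, mul_one]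
  | succ n ih =>
    have hunion : {v | G.dist x v ≤ n + 1} =
        {v | G.dist x v ≤ n} ∪ {v | G.dist x v = n + 1} := by
      ext v
      simp only [Set.mem_ofPred_eq, Set.mem_union]
      omega
    have hle := Set.ncard_union_le {v | G.dist x v ≤ n} {v | G.dist x v = n + 1}
    rw [← hunion] at hle
    have hs := hG.card_sphere_le hdeg x n
    have hpow : 2 * D ^ n ≤ D * D ^ n := Nat.mul_le_mul_right _ hD
    rw [pow_succ']
    linarith

/-- Let `Δ ≥ 4` and `d ≥ 1` be integers. For every tree `T` with
maximum degree at most `Δ − 1` and every `T`-partition `(B u : u ∈ V(T))` of the complete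
tree `X_{Δ,d}`, there exists a node `u ∈ V(T)` with
`|B u| ≥ |V(X_{Δ,d})| / (3·(Δ−2)^d)`. -/
theorem exists_large_part_of_treePartition (Δ d : ℕ) (hΔ : 4 ≤ Δ) (hd : 1 ≤ d)
    {κ ι : Type} [Fintype κ] [Fintype ι]
    (X : SimpleGraph κ) (r : κ) (hX : IsCompleteTree Δ d X r)
    (T : SimpleGraph ι) (B : ι → Set κ)
    (hdeg : ∀ x, (T.neighborSet x).ncard ≤ Δ - 1)
    (hB : IsTreePartition X T B) :
    ∃ u, (Fintype.card κ : ℝ) / (3 * ((Δ : ℝ) - 2) ^ d) ≤ ((B u).ncard : ℝ) := by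
  classical
  choose f hf hfu using hB.part_existsUnique
  have hdist : ∀ x, T.dist (f r) x ≤ d := by
    intro x
    obtain ⟨v, hv⟩ := hB.part_nonempty x
    rw [hfu v x hv]
    exact (hX.1.connected.dist_map_le hB.isTree.connected f
      (fun v w h => hB.part_adj h (hf v) (hf w)) r v).trans (hX.dist_le (by omega) v)
  obtain ⟨D, rfl⟩ : ∃ D, Δ = D + 2 := ⟨Δ - 2, by omega⟩
  have hcard : Fintype.card ι + 2 ≤ 3 * D ^ d := by
    simpa [hdist] using hB.isTree.connected.card_ball_le (by omega) hdeg (f r) d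
  have hD : 0 < (D : ℝ) := by exact_mod_cast (show 0 < D by omega)
  have hle : (Fintype.card ι : ℝ) ≤ 3 * (D : ℝ) ^ d := by
    exact_mod_cast (show Fintype.card ι ≤ 3 * D ^ d by omega)
  have : Nonempty ι := ⟨f r⟩
  obtain ⟨u, hu⟩ := Fintype.exists_le_card_fiber_of_nsmul_le_card f
    (b := (Fintype.card κ : ℝ) / (3 * (D : ℝ) ^ d)) (by
      rw [nsmul_eq_mul, mul_div_assoc', div_le_iff₀ (by positivity), mul_comm]
      exact mul_le_mul_of_nonneg_left hle (Nat.cast_nonneg _))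
  refine ⟨u, ?_⟩
  have hBu : B u = {v | f v = u} := by
    ext v
    exact ⟨fun h => (hfu v u h).symm, fun h => h ▸ hf v⟩
  rw [hBu, Set.ncard_eq_toFinset_card', Set.toFinset_ofPred]
  simpa using hu
end
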